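/- The Rogers–Ramanujan functions satisfy G(q) = 1/([1,5;q]⁻) and H(q) = 1/([2,5;q]⁻): that is, ∑_{n=0}^∞ q^{n²}/(q;q)_n = ∏_{n=0}^∞ 1/((1 − q^{5n+1})(1 − q^{5n+4})) and ∑_{n=0}^∞ q^{n²+n}/(q;q)_n = ∏_{n=0}^∞ 1/((1 − q^{5n+2})(1 − q^{5n+3})) for 0 < q < 1. -/

import Mathlib

namespace RogersRamanujan

open Filter Topology

/-- The reciprocal `1 / (q; q)_k` of the `q`-Pochhammer symbol, extended by zero to `k < 0`. -/
noncomputable def qInv (q : ℝ) (k : ℤ) : ℝ :=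
  if k < 0 then 0 else (∏ i ∈ Finset.range k.toNat, (1 - q ^ (i + 1)))⁻¹

/-- The value `1 / (q; q)_∞`. -/
noncomputable def qInvInf (q : ℝ) : ℝ := (∏' i : ℕ, (1 - q ^ (i + 1)))⁻¹

/-- The triangular number `r (r - 1) / 2`. -/
def tri (r : ℤ) : ℤ := r * (r - 1) / 2

lemma two_mul_tri (r : ℤ) : 2 * tri r = r * (r - 1) := by
  have h : 2 ∣ r * (r - 1) := (Int.even_mul_pred_self r).two_dvd
  unfold tri
  omega

lemma tri_add_one (r : ℤ) : tri (r + 1) = tri r + r := by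
  have h1 := two_mul_tri r
  have h2 := two_mul_tri (r + 1)
  have h3 : (r + 1) * (r + 1 - 1) = r * (r - 1) + 2 * r := by ring
  omega

lemma qInv_of_neg (q : ℝ) {k : ℤ} (hk : k < 0) : qInv q k = 0 := if_pos hk

lemma qInv_natCast (q : ℝ) (n : ℕ) :
    qInv q n = (∏ i ∈ Finset.range n, (1 - q ^ (i + 1)))⁻¹ := by
  simp [qInv]

lemma qInv_zero (q : ℝ) : qInv q 0 = 1 := by simp [qInv]

section

variable {q : ℝ}

lemma one_sub_pow_pos (hq : 0 < q) (hq1 : q < 1) {n : ℕ} (hn : n ≠ 0) : 0 < 1 - q ^ n :=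
  sub_pos.2 (pow_lt_one₀ hq.le hq1 hn)

lemma qInv_sub_one (hq : 0 < q) (hq1 : q < 1) (k : ℤ) :
    qInv q (k - 1) = (1 - q ^ k) * qInv q k := by
  rcases lt_trichotomy k 0 with h | rfl | h
  · rw [qInv_of_neg q h, qInv_of_neg q (by omega), mul_zero]
  · rw [qInv_of_neg q (by omega)]; simp
  · obtain ⟨n, rfl⟩ : ∃ n : ℕ, k = (n + 1 : ℕ) := ⟨(k - 1).toNat, by omega⟩
    have h1 : ((n + 1 : ℕ) : ℤ) - 1 = (n : ℕ) := by push_cast; ring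
    have h2 := (one_sub_pow_pos hq hq1 n.succ_ne_zero).ne'
    rw [h1, qInv_natCast, qInv_natCast, Finset.prod_range_succ, zpow_natCast, mul_inv]
    field_simp

lemma qInv_nonneg (hq : 0 < q) (hq1 : q < 1) (k : ℤ) : 0 ≤ qInv q k := by
  unfold qInv
  split_ifs
  · rfl
  · exact inv_nonneg.2 (Finset.prod_nonneg fun i _ ↦ (one_sub_pow_pos hq hq1 i.succ_ne_zero).le)

lemma multipliable_one_add_mul_pow (hq : 0 < q) (hq1 : q < 1) (x : ℝ) :
    Multipliable fun i : ℕ ↦ 1 + x * q ^ i :=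
  Real.multipliable_one_add_of_summable
    ((summable_geometric_of_lt_one hq.le hq1).mul_left x)

lemma summable_pow_mul_add (hq : 0 < q) (hq1 : q < 1) {k : ℕ} (hk : k ≠ 0) (u : ℕ) :
    Summable fun i : ℕ ↦ q ^ (k * i + u) := by
  refine ((summable_geometric_of_lt_one (pow_nonneg hq.le k)
    (pow_lt_one₀ hq.le hq1 hk)).mul_left (q ^ u)).congr fun i ↦ ?_
  ring

lemma multipliable_one_sub_pow (hq : 0 < q) (hq1 : q < 1) {k : ℕ} (hk : k ≠ 0) (u : ℕ) :
    Multipliable fun i : ℕ ↦ 1 - q ^ (k * i + u) := by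
  simpa only [← sub_eq_add_neg] using
    Real.multipliable_one_add_of_summable (summable_pow_mul_add hq hq1 hk u).neg

lemma tprod_one_sub_pow_ne_zero (hq : 0 < q) (hq1 : q < 1) {k u : ℕ} (hk : k ≠ 0) (hu : u ≠ 0) :
    ∏' i : ℕ, (1 - q ^ (k * i + u)) ≠ 0 := by
  have h := tprod_one_add_ne_zero_of_summable (f := fun i : ℕ ↦ -q ^ (k * i + u))
    (fun i ↦ by
      rw [← sub_eq_add_neg]
      exact (one_sub_pow_pos hq hq1 (by omega)).ne')
    (summable_pow_mul_add hq hq1 hk u).neg.norm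
  simpa only [← sub_eq_add_neg] using h

lemma tprod_one_sub_pow_succ_ne_zero (hq : 0 < q) (hq1 : q < 1) :
    ∏' i : ℕ, (1 - q ^ (i + 1)) ≠ 0 := by
  simpa using tprod_one_sub_pow_ne_zero hq hq1 one_ne_zero one_ne_zero

lemma tendsto_qInv_natCast (hq : 0 < q) (hq1 : q < 1) :
    Tendsto (fun n : ℕ ↦ qInv q n) atTop (𝓝 (qInvInf q)) := by
  simp only [qInv_natCast]
  have h : Multipliable fun i : ℕ ↦ 1 - q ^ (i + 1) := by
    simpa using multipliable_one_sub_pow hq hq1 one_ne_zero 1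
  exact h.hasProd.tendsto_prod_nat.inv₀ (tprod_one_sub_pow_succ_ne_zero hq hq1)

lemma tendsto_qInv (hq : 0 < q) (hq1 : q < 1) :
    Tendsto (qInv q) atTop (𝓝 (qInvInf q)) := by
  have h : Tendsto Int.toNat atTop atTop :=
    tendsto_atTop.2 fun b ↦ (eventually_ge_atTop (b : ℤ)).mono fun a ha ↦ by omega
  refine ((tendsto_qInv_natCast hq hq1).comp h).congr' ?_
  filter_upwards [eventually_ge_atTop 0] with k hk
  simp [Int.toNat_of_nonneg hk]

lemma qInvInf_ne_zero (hq : 0 < q) (hq1 : q < 1) : qInvInf q ≠ 0 :=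
  inv_ne_zero (tprod_one_sub_pow_succ_ne_zero hq hq1)

lemma qInv_le (hq : 0 < q) (hq1 : q < 1) (k : ℤ) : qInv q k ≤ qInvInf q := by
  have hmono : Monotone (qInv q) := monotone_int_of_le_succ fun k ↦ by
    by_cases hk : k + 1 < 0
    · rw [qInv_of_neg q hk, qInv_of_neg q (by omega)]
    · have h := qInv_sub_one hq hq1 (k + 1)
      rw [add_sub_cancel_right] at h
      rw [h]
      have : 0 < q ^ (k + 1) := zpow_pos hq _
      nlinarith [qInv_nonneg hq hq1 (k + 1)]
  exact hmono.ge_of_tendsto (tendsto_qInv hq hq1) k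

/-- A finite form of the Jacobi triple product identity. -/
lemma hasSum_finite_triple_product (hq : 0 < q) (hq1 : q < 1) {x : ℝ} (hx : x ≠ 0) (n m : ℕ) :
    HasSum (fun r : ℤ ↦ x ^ r * q ^ tri r * (qInv q (n - r) * qInv q (m + r)))
      (qInv q (n + m : ℕ) * ((∏ i ∈ Finset.range n, (1 + x * q ^ i)) *
        ∏ i ∈ Finset.range m, (1 + q ^ (i + 1) / x))) := by
  have hq0 := hq.ne'
  induction n with
  | zero =>
    induction m with
    | zero =>
      convert hasSum_single (0 : ℤ) ?_ using 1
      · simp [tri, qInv_zero]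
      · intro r hr
        rcases lt_or_gt_of_ne hr with h | h
        · rw [qInv_of_neg q (k := ((0 : ℕ) : ℤ) + r) (by simpa using h)]; simp
        · rw [qInv_of_neg q (k := ((0 : ℕ) : ℤ) - r) (by simpa using h)]; simp
    | succ m ih =>
      have hd := (one_sub_pow_pos hq hq1 (n := m + 1) (by omega)).ne'
      convert! (ih.add (((Equiv.addRight (1 : ℤ)).hasSum_iff.2 ih).mul_left
        (q ^ (m + 1) / x))).mul_left (1 - q ^ (m + 1))⁻¹ using 1
      · ext r
        have e1 := qInv_sub_one hq hq1 (m + 1 + r)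
        have e2 := qInv_sub_one hq hq1 (-r)
        rw [show (m : ℤ) + 1 + r - 1 = m + r by ring] at e1
        have hA : (q : ℝ) ^ (m + 1 : ℕ) = q ^ (m + 1 + r : ℤ) * q ^ (-r) := by
          rw [← zpow_add₀ hq0, ← zpow_natCast]; congr 1; push_cast; ring
        have hB : q ^ tri (r + 1) = q ^ tri r * (q ^ (-r))⁻¹ := by
          rw [tri_add_one, zpow_add₀ hq0, zpow_neg, inv_inv]
        have hC : q ^ (-r) ≠ 0 := zpow_ne_zero _ hq0
        simp only [Function.comp_apply, Equiv.coe_addRight, Nat.cast_zero, zero_sub, Nat.cast_add,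
          Nat.cast_one]
        rw [show -(r + 1) = -r - 1 by ring, show (m : ℤ) + (r + 1) = m + 1 + r by ring, e1, e2, hB,
          zpow_add_one₀ hx]
        rw [eq_inv_mul_iff_mul_eq₀ hd, hA]
        field_simp
        ring
      · have e1 := qInv_sub_one hq hq1 ((m + 1 : ℕ) : ℤ)
        rw [show ((m + 1 : ℕ) : ℤ) - 1 = (m : ℕ) by push_cast; ring, zpow_natCast] at e1
        rw [zero_add, zero_add, e1, Finset.prod_range_succ]
        field_simp
  | succ n ih =>
    have hd := (one_sub_pow_pos hq hq1 (n := n + 1 + m) (by omega)).ne'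
    convert! (ih.add (((Equiv.subRight (1 : ℤ)).hasSum_iff.2 ih).mul_left
      (x * q ^ n))).mul_left (1 - q ^ (n + 1 + m))⁻¹ using 1
    · ext r
      have e1 := qInv_sub_one hq hq1 (n + 1 - r)
      have e2 := qInv_sub_one hq hq1 (m + r)
      rw [show (n : ℤ) + 1 - r - 1 = n - r by ring] at e1
      have hA : (q : ℝ) ^ (n + 1 + m : ℕ) = q ^ (n + 1 - r : ℤ) * q ^ (m + r : ℤ) := by
        rw [← zpow_add₀ hq0, ← zpow_natCast]; congr 1; push_cast; ring
      have hB : q ^ n * q ^ tri (r - 1) = q ^ tri r * q ^ (n + 1 - r : ℤ) := by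
        have := tri_add_one (r - 1)
        rw [sub_add_cancel] at this
        rw [this, ← zpow_add₀ hq0, ← zpow_natCast, ← zpow_add₀ hq0]; congr 1; ring
      simp only [Function.comp_apply, Equiv.subRight_apply, Nat.cast_add, Nat.cast_one]
      rw [show (n : ℤ) - (r - 1) = n + 1 - r by ring, show (m : ℤ) + (r - 1) = m + r - 1 by ring,
        e1, e2, zpow_sub_one₀ hx, eq_inv_mul_iff_mul_eq₀ hd, hA]
      have hD : x * q ^ n * (x ^ r * x⁻¹ * q ^ tri (r - 1) *
          (qInv q (n + 1 - r) * ((1 - q ^ (m + r : ℤ)) * qInv q (m + r)))) =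
          x ^ r * (q ^ n * q ^ tri (r - 1)) *
          (qInv q (n + 1 - r) * ((1 - q ^ (m + r : ℤ)) * qInv q (m + r))) := by
        field_simp
      rw [hD, hB]
      ring
    · have e1 := qInv_sub_one hq hq1 ((n + 1 + m : ℕ) : ℤ)
      rw [show ((n + 1 + m : ℕ) : ℤ) - 1 = (n + m : ℕ) by push_cast; ring, zpow_natCast] at e1
      rw [e1, Finset.prod_range_succ]
      field_simp

/-- The limiting case of the `q`-Vandermonde sum underlying Bailey's lemma. -/
lemma hasSum_qVandermonde (hq : 0 < q) (hq1 : q < 1) (N : ℕ) (c : ℤ) :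
    HasSum (fun n : ℤ ↦ q ^ (n * (n + c)) * (qInv q (N - n) * (qInv q n * qInv q (n + c))))
      (qInv q N * qInv q (N + c)) := by
  have hq0 := hq.ne'
  induction N generalizing c with
  | zero =>
    convert hasSum_single (0 : ℤ) ?_ using 1
    · simp [qInv_zero]
    · intro r hr
      rcases lt_or_gt_of_ne hr with h | h
      · rw [qInv_of_neg q h]; simp
      · rw [qInv_of_neg q (k := ((0 : ℕ) : ℤ) - r) (by simpa using h)]; simp
  | succ N ih =>
    have hd := (one_sub_pow_pos hq hq1 (n := N + 1) (by omega)).ne'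
    have hA : Summable fun n : ℤ ↦
        q ^ (n * (n + c)) * (qInv q (N + 1 - n) * (qInv q (n - 1) * qInv q (n + c))) := by
      refine summable_of_ne_finset_zero (s := Finset.Icc 0 ((N : ℤ) + 1)) fun n hn ↦ ?_
      rw [Finset.mem_Icc, not_and_or, not_le, not_le] at hn
      rcases hn with h | h
      · rw [qInv_of_neg q (k := n - 1) (by omega)]; simp
      · rw [qInv_of_neg q (k := (N : ℤ) + 1 - n) (by omega)]; simp
    convert! ((ih (c + 1)).add (hA.hasSum.sub
      ((Equiv.addRight (1 : ℤ)).hasSum_iff.2 hA.hasSum))).mul_left (1 - q ^ (N + 1))⁻¹ using 1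
    · ext n
      have e1 := qInv_sub_one hq hq1 (N + 1 - n)
      have e2 := qInv_sub_one hq hq1 n
      have e3 := qInv_sub_one hq hq1 (n + c + 1)
      rw [show (N : ℤ) + 1 - n - 1 = N - n by ring] at e1
      rw [add_sub_cancel_right] at e3
      have h1 : (q : ℝ) ^ (N + 1 : ℕ) = q ^ (N + 1 - n : ℤ) * q ^ n := by
        rw [← zpow_add₀ hq0, ← zpow_natCast]; congr 1; push_cast; ring
      have h2 : q ^ (n * (n + (c + 1))) = q ^ (n * (n + c)) * q ^ n := by
        rw [← zpow_add₀ hq0]; congr 1; ring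
      have h3 : q ^ ((n + 1) * (n + 1 + c)) = q ^ (n * (n + c)) * q ^ n * q ^ (n + c + 1) := by
        rw [← zpow_add₀ hq0, ← zpow_add₀ hq0]; congr 1; ring
      simp only [Function.comp_apply, Equiv.coe_addRight, Nat.cast_add, Nat.cast_one]
      rw [eq_inv_mul_iff_mul_eq₀ hd, h1, h2, h3, add_sub_cancel_right,
        show n + (c + 1) = n + c + 1 by ring, show n + 1 + c = n + c + 1 by ring,
        show (N : ℤ) + 1 - (n + 1) = N - n by ring, e1, e2, e3]
      ring
    · have e1 := qInv_sub_one hq hq1 ((N + 1 : ℕ) : ℤ)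
      rw [show ((N + 1 : ℕ) : ℤ) - 1 = (N : ℕ) by push_cast; ring, zpow_natCast] at e1
      rw [e1, sub_self, add_zero, show ((N + 1 : ℕ) : ℤ) + c = N + (c + 1) by push_cast; ring]
      field_simp

lemma sum_bailey_kernel (hq : 0 < q) (hq1 : q < 1) {a : ℕ} (ha : a ≤ 1) (N : ℕ) (r : ℤ) :
    ∑ n ∈ Finset.range (N + 1), q ^ (n ^ 2 + a * n) * qInv q (N - n) *
        (qInv q (n - r) * qInv q (n + a + r)) =
      q ^ (r ^ 2 + a * r) * (qInv q (N - r) * qInv q (N + a + r)) := by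
  have hq0 := hq.ne'
  rcases lt_or_ge (N : ℤ) r with hr | hr
  · rw [qInv_of_neg q (k := (N : ℤ) - r) (by omega), zero_mul, mul_zero]
    refine Finset.sum_eq_zero fun n hn ↦ ?_
    rw [Finset.mem_range] at hn
    rw [qInv_of_neg q (k := (n : ℤ) - r) (by omega), zero_mul, mul_zero]
  obtain ⟨M, hM⟩ : ∃ M : ℕ, (N : ℤ) - r = M := ⟨((N : ℤ) - r).toNat, by omega⟩
  have h := ((Equiv.subRight r).hasSum_iff.2
    (hasSum_qVandermonde hq hq1 M (2 * r + a))).mul_left (q ^ (r ^ 2 + a * r))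
  rw [← hM, show (N : ℤ) - r + (2 * r + a) = N + a + r by ring] at h
  rw [← Function.Injective.hasSum_iff (g := ((↑) : ℕ → ℤ)) Nat.cast_injective] at h
  · refine (hasSum_sum_of_ne_finset_zero fun n hn ↦ ?_).unique (h.congr_fun ?_)
    · rw [Finset.mem_range, not_lt] at hn
      rw [qInv_of_neg q (k := (N : ℤ) - n) (by omega), mul_zero, zero_mul]
    · intro n
      have h1 : (q : ℝ) ^ (n ^ 2 + a * n) =
          q ^ (r ^ 2 + a * r) * q ^ ((n - r) * (n - r + (2 * r + a))) := by
        rw [← zpow_add₀ hq0, ← zpow_natCast]; congr 1; push_cast; ring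
      simp only [Function.comp_apply, Equiv.subRight_apply]
      rw [h1, show (N : ℤ) - r - (n - r) = N - n by ring,
        show (n : ℤ) - r + (2 * r + a) = n + a + r by ring]
      ring
  · intro n hn
    have hn0 : n < 0 := by
      by_contra! h0
      exact hn ⟨n.toNat, by simp [h0]⟩
    simp only [Function.comp_apply, Equiv.subRight_apply]
    rcases lt_or_ge n r with h' | h'
    · rw [qInv_of_neg q (k := n - r) (by omega)]; simp
    · rw [qInv_of_neg q (k := n - r + (2 * r + a)) (by omega)]; simp

/-- Bailey's lemma for the limiting parameters, relative to `a = 1` and `a = q`. -/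
lemma bailey (hq : 0 < q) (hq1 : q < 1) {a : ℕ} (ha : a ≤ 1) {α : ℤ → ℝ} {β : ℕ → ℝ}
    (h : ∀ n : ℕ, HasSum (fun r ↦ α r * (qInv q (n - r) * qInv q (n + a + r))) (β n)) (N : ℕ) :
    HasSum (fun r : ℤ ↦ q ^ (r ^ 2 + a * r) * α r * (qInv q (N - r) * qInv q (N + a + r)))
      (∑ n ∈ Finset.range (N + 1), q ^ (n ^ 2 + a * n) * qInv q (N - n) * β n) := by
  refine (hasSum_sum (s := Finset.range (N + 1)) fun n _ ↦
    (h n).mul_left (q ^ (n ^ 2 + a * n) * qInv q (N - n))).congr_fun fun r ↦ ?_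
  rw [mul_right_comm, ← sum_bailey_kernel hq hq1 ha N r, Finset.sum_mul]
  exact Finset.sum_congr rfl fun n _ ↦ by ring

lemma hasSum_unit_bailey_pair (hq : 0 < q) (hq1 : q < 1) {a : ℕ} (ha : a ≤ 1) (n : ℕ) :
    HasSum (fun r ↦ (-1) ^ r * q ^ tri r * (qInv q (n - r) * qInv q (n + a + r)))
      (if n = 0 then 1 else 0) := by
  convert hasSum_finite_triple_product hq hq1 (x := -1) (by norm_num) n (n + a) using 1
  · simp
  · rcases n with _ | n
    · have h1 : (1 : ℝ) - q ≠ 0 := by linarith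
      interval_cases a
      · simp [qInv_zero]
      · simp only [qInv_natCast]
        simp [div_neg, ← sub_eq_add_neg, h1]
    · simp [Finset.prod_range_succ']

/-- A finite form of the Rogers–Ramanujan identities. -/
lemma hasSum_finite_rogers_ramanujan (hq : 0 < q) (hq1 : q < 1) {a : ℕ} (ha : a ≤ 1) (N : ℕ) :
    HasSum (fun r : ℤ ↦ q ^ (r ^ 2 + a * r) * (q ^ (r ^ 2 + a * r) * ((-1) ^ r * q ^ tri r)) *
        (qInv q (N - r) * qInv q (N + a + r)))
      (∑ n ∈ Finset.range (N + 1), q ^ (n ^ 2 + a * n) * qInv q (N - n) * qInv q n) := by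
  refine bailey hq hq1 ha (fun n ↦ ?_) N
  convert bailey hq hq1 ha (hasSum_unit_bailey_pair hq hq1 ha) n using 1
  rw [Finset.sum_eq_single 0] <;> simp +contextual

lemma tendsto_tsum_mul_qInv (hq : 0 < q) (hq1 : q < 1) (a : ℕ) {c : ℤ → ℝ} (hc : Summable c) :
    Tendsto (fun N : ℕ ↦ ∑' r, c r * (qInv q (N - r) * qInv q (N + a + r))) atTop
      (𝓝 ((∑' r, c r) * (qInvInf q * qInvInf q))) := by
  rw [← tsum_mul_right]
  refine tendsto_tsum_of_dominated_convergence
    (bound := fun r ↦ ‖c r‖ * (qInvInf q * qInvInf q)) (hc.norm.mul_right _) (fun r ↦ ?_)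
    (Eventually.of_forall fun N r ↦ ?_)
  · refine Tendsto.const_mul _ (Tendsto.mul ?_ ?_)
    · exact (tendsto_qInv hq hq1).comp
        (tendsto_atTop_add_const_right _ (-r) tendsto_natCast_atTop_atTop)
    · exact (tendsto_qInv hq hq1).comp (tendsto_atTop_add_const_right _ r
        (tendsto_atTop_add_const_right _ (a : ℤ) tendsto_natCast_atTop_atTop))
  · have h1 := qInv_nonneg hq hq1 (N - r)
    have h2 := qInv_nonneg hq hq1 (N + a + r)
    rw [norm_mul, Real.norm_of_nonneg (mul_nonneg h1 h2)]
    gcongr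
    · exact h1.trans (qInv_le hq hq1 _)
    · exact qInv_le hq hq1 _
    · exact qInv_le hq hq1 _

lemma tendsto_sum_mul_qInv (hq : 0 < q) (hq1 : q < 1) {c : ℕ → ℝ} (hc : Summable c) :
    Tendsto (fun N : ℕ ↦ ∑ n ∈ Finset.range (N + 1), c n * qInv q (N - n)) atTop
      (𝓝 ((∑' n, c n) * qInvInf q)) := by
  have h (N : ℕ) : ∑ n ∈ Finset.range (N + 1), c n * qInv q (N - n) =
      ∑' n : ℕ, c n * qInv q (N - n) := by
    refine (tsum_eq_sum fun n hn ↦ ?_).symm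
    rw [Finset.mem_range, not_lt] at hn
    rw [qInv_of_neg q (by omega), mul_zero]
  simp only [h, ← tsum_mul_right]
  refine tendsto_tsum_of_dominated_convergence
    (bound := fun n ↦ ‖c n‖ * qInvInf q) (hc.norm.mul_right _) (fun n ↦ ?_)
    (Eventually.of_forall fun N n ↦ ?_)
  · exact ((tendsto_qInv hq hq1).comp (tendsto_atTop_add_const_right _ (-(n : ℤ))
      tendsto_natCast_atTop_atTop)).const_mul _
  · rw [norm_mul, Real.norm_of_nonneg (qInv_nonneg hq hq1 _)]
    gcongr
    exact qInv_le hq hq1 _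

lemma summable_neg_one_zpow_mul_zpow (hq : 0 < q) (hq1 : q < 1) {f : ℤ → ℤ}
    (hf : ∀ r, |r| ≤ f r) : Summable fun r : ℤ ↦ (-1) ^ r * q ^ f r := by
  have h : Summable fun r : ℤ ↦ q ^ |r| := by
    apply Summable.of_nat_of_neg <;> simpa using summable_geometric_of_lt_one hq.le hq1
  refine Summable.of_norm_bounded h fun r ↦ ?_
  rw [norm_mul, norm_zpow, norm_neg, norm_one, one_zpow, one_mul,
    Real.norm_of_nonneg (zpow_pos hq _).le]
  exact zpow_le_zpow_right_of_le_one₀ hq hq1.le (hf r)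

/-- The Jacobi triple product identity. -/
lemma tsum_triple_product (hq : 0 < q) (hq1 : q < 1) {x : ℝ} (hx : x ≠ 0)
    (hs : Summable fun r : ℤ ↦ x ^ r * q ^ tri r) :
    (∑' r : ℤ, x ^ r * q ^ tri r) * qInvInf q =
      (∏' i : ℕ, (1 + x * q ^ i)) * ∏' i : ℕ, (1 + q ^ (i + 1) / x) := by
  have h1 := tendsto_tsum_mul_qInv hq hq1 0 hs
  have h2 : Multipliable fun i : ℕ ↦ 1 + q ^ (i + 1) / x :=
    (multipliable_one_add_mul_pow hq hq1 (q / x)).congr fun i ↦ by ring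
  have h3 : Tendsto (fun n : ℕ ↦ n + n) atTop atTop :=
    tendsto_atTop_mono (fun n ↦ Nat.le_add_left n n) tendsto_id
  have h4 := ((tendsto_qInv_natCast hq hq1).comp h3).mul
    ((multipliable_one_add_mul_pow hq hq1 x).hasProd.tendsto_prod_nat.mul
      h2.hasProd.tendsto_prod_nat)
  have h5 := tendsto_nhds_unique h1 (h4.congr fun n ↦ by
    simpa using (hasSum_finite_triple_product hq hq1 hx n n).tsum_eq.symm)
  exact mul_left_cancel₀ (qInvInf_ne_zero hq hq1) (by linarith)

lemma neg_pow_tri_term (hq : 0 < q) (a : ℕ) (r : ℤ) :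
    (-q ^ (2 + 2 * a)) ^ r * (q ^ 5) ^ tri r =
      (-1) ^ r * q ^ ((r ^ 2 + a * r) + (r ^ 2 + a * r) + tri r) := by
  have h := two_mul_tri r
  rw [neg_eq_neg_one_mul, mul_zpow, mul_assoc, ← zpow_natCast, ← zpow_natCast, ← zpow_mul,
    ← zpow_mul, ← zpow_add₀ hq.ne']
  congr 2
  push_cast
  linarith

lemma summable_pow_mul_qInv (hq : 0 < q) (hq1 : q < 1) (a : ℕ) :
    Summable fun n : ℕ ↦ q ^ (n ^ 2 + a * n) * qInv q n := by
  refine Summable.of_nonneg_of_le (fun n ↦ mul_nonneg (by positivity) (qInv_nonneg hq hq1 _))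
    (fun n ↦ ?_) ((summable_geometric_of_lt_one hq.le hq1).mul_right (qInvInf q))
  refine mul_le_mul ?_ (qInv_le hq hq1 _) (qInv_nonneg hq hq1 _) (by positivity)
  exact pow_le_pow_of_le_one hq.le hq1.le (by nlinarith)

/-- The Rogers–Ramanujan series as a theta series divided by `(q; q)_∞`. -/
lemma tsum_pow_mul_qInv (hq : 0 < q) (hq1 : q < 1) {a : ℕ} (ha : a ≤ 1)
    (hs : Summable fun r : ℤ ↦ (-q ^ (2 + 2 * a)) ^ r * (q ^ 5) ^ tri r) :
    ∑' n : ℕ, q ^ (n ^ 2 + a * n) * qInv q n =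
      qInvInf q * ∑' r : ℤ, (-q ^ (2 + 2 * a)) ^ r * (q ^ 5) ^ tri r := by
  have h1 := tendsto_sum_mul_qInv hq hq1 (summable_pow_mul_qInv hq hq1 a)
  have h2 := tendsto_tsum_mul_qInv hq hq1 a hs
  have h3 := tendsto_nhds_unique h1 (h2.congr fun N ↦ ?_)
  · exact mul_right_cancel₀ (qInvInf_ne_zero hq hq1) (by linarith)
  · rw [Finset.sum_congr rfl fun n _ ↦ mul_right_comm _ _ _,
      ← (hasSum_finite_rogers_ramanujan hq hq1 ha N).tsum_eq]
    refine tsum_congr fun r ↦ ?_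
    rw [neg_pow_tri_term hq, zpow_add₀ hq.ne', zpow_add₀ hq.ne']
    ring

lemma qInv_five_mul_mul_prod (hq : 0 < q) (hq1 : q < 1) {s t u v : ℕ} (hu : u ≠ 0) (hv : v ≠ 0)
    (h : ∀ i : ℕ, (1 - q ^ (5 * i + s)) * (1 - q ^ (5 * i + t)) *
      ((1 - q ^ (5 * i + u)) * (1 - q ^ (5 * i + v))) =
      (1 - q ^ (5 * i + 1)) * (1 - q ^ (5 * i + 2)) * (1 - q ^ (5 * i + 3)) *
      (1 - q ^ (5 * i + 4))) (n : ℕ) :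
    qInv q (5 * n : ℕ) * ((∏ i ∈ Finset.range n, (1 - q ^ (5 * i + s))) *
        ∏ i ∈ Finset.range n, (1 - q ^ (5 * i + t))) =
      qInv (q ^ 5) n *
        ∏ i ∈ Finset.range n, (1 / ((1 - q ^ (5 * i + u)) * (1 - q ^ (5 * i + v)))) := by
  induction n with
  | zero => simp [qInv_zero]
  | succ n ih =>
    have hp (k : ℕ) (hk : k ≠ 0) : 1 - q ^ (5 * n + k) ≠ 0 :=
      (one_sub_pow_pos hq hq1 (by omega)).ne'
    have h1 := hp 1 (by omega)
    have h2 := hp 2 (by omega)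
    have h3 := hp 3 (by omega)
    have h4 := hp 4 (by omega)
    have h5 := hp 5 (by omega)
    have hL : qInv q (5 * (n + 1) : ℕ) = qInv q (5 * n : ℕ) *
        ((1 - q ^ (5 * n + 1)) * (1 - q ^ (5 * n + 2)) * (1 - q ^ (5 * n + 3)) *
        (1 - q ^ (5 * n + 4)) * (1 - q ^ (5 * n + 5)))⁻¹ := by
      rw [qInv_natCast, qInv_natCast, show 5 * (n + 1) = 5 * n + 1 + 1 + 1 + 1 + 1 by ring]
      simp only [Finset.prod_range_succ, mul_inv, add_assoc, mul_assoc, Nat.reduceAdd]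
    have hR : qInv (q ^ 5) (n + 1 : ℕ) = qInv (q ^ 5) n * (1 - q ^ (5 * n + 5))⁻¹ := by
      rw [qInv_natCast, qInv_natCast, Finset.prod_range_succ, mul_inv, ← pow_mul, mul_add, mul_one]
    have hu' := hp u hu
    have hv' := hp v hv
    rw [hL, hR, Finset.prod_range_succ, Finset.prod_range_succ, Finset.prod_range_succ, ← h n]
    have hst : (1 - q ^ (5 * n + s)) * (1 - q ^ (5 * n + t)) ≠ 0 :=
      left_ne_zero_of_mul (b := (1 - q ^ (5 * n + u)) * (1 - q ^ (5 * n + v))) <| by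
        rw [h n]
        exact mul_ne_zero (mul_ne_zero (mul_ne_zero h1 h2) h3) h4
    have hs := left_ne_zero_of_mul hst
    have ht := right_ne_zero_of_mul hst
    calc _ = (qInv q (5 * n : ℕ) * ((∏ i ∈ Finset.range n, (1 - q ^ (5 * i + s))) *
        ∏ i ∈ Finset.range n, (1 - q ^ (5 * i + t)))) *
        (1 / ((1 - q ^ (5 * n + u)) * (1 - q ^ (5 * n + v))) * (1 - q ^ (5 * n + 5))⁻¹) := by
          field_simp
      _ = _ := by rw [ih]; ring

lemma rogers_ramanujan (hq : 0 < q) (hq1 : q < 1) {a t u v : ℕ} (ha : a ≤ 1)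
    (hst : 2 + 2 * a + t = 5) (hu : u ≠ 0) (hv : v ≠ 0)
    (h : ∀ i : ℕ, (1 - q ^ (5 * i + (2 + 2 * a))) * (1 - q ^ (5 * i + t)) *
      ((1 - q ^ (5 * i + u)) * (1 - q ^ (5 * i + v))) =
      (1 - q ^ (5 * i + 1)) * (1 - q ^ (5 * i + 2)) * (1 - q ^ (5 * i + 3)) *
      (1 - q ^ (5 * i + 4))) :
    ∑' n : ℕ, q ^ (n ^ 2 + a * n) / ∏ k ∈ Finset.range n, (1 - q ^ (k + 1)) =
      ∏' n : ℕ, (1 / ((1 - q ^ (5 * n + u)) * (1 - q ^ (5 * n + v)))) := by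
  have h5 : (5 : ℕ) ≠ 0 := by norm_num
  have hp : 0 < q ^ 5 := by positivity
  have hp1 : q ^ 5 < 1 := pow_lt_one₀ hq.le hq1 h5
  have hx : -q ^ (2 + 2 * a) ≠ 0 := neg_ne_zero.2 (by positivity)
  have hs : Summable fun r : ℤ ↦ (-q ^ (2 + 2 * a)) ^ r * (q ^ 5) ^ tri r := by
    simp only [neg_pow_tri_term hq]
    refine summable_neg_one_zpow_mul_zpow hq hq1 fun r ↦ ?_
    have h2 := two_mul_tri r
    interval_cases a <;> refine abs_le'.2 ⟨?_, ?_⟩ <;> push_cast <;>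
      rcases lt_trichotomy r 0 with h0 | rfl | h0 <;> nlinarith
  have h1 := tsum_triple_product hp hp1 hx hs
  have e1 (i : ℕ) : 1 + -q ^ (2 + 2 * a) * (q ^ 5) ^ i = 1 - q ^ (5 * i + (2 + 2 * a)) := by ring
  have e2 (i : ℕ) : 1 + (q ^ 5) ^ (i + 1) / -q ^ (2 + 2 * a) = 1 - q ^ (5 * i + t) := by
    rw [div_neg, ← sub_eq_add_neg, ← pow_mul,
      show 5 * (i + 1) = 5 * i + t + (2 + 2 * a) by omega, pow_add,
      mul_div_cancel_right₀ _ (by positivity)]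
  simp only [e1, e2] at h1
  have h3 : Tendsto (fun n : ℕ ↦ 5 * n) atTop atTop :=
    tendsto_atTop_mono (fun n ↦ Nat.le_mul_of_pos_left n (by norm_num)) tendsto_id
  have hm (k : ℕ) := multipliable_one_sub_pow hq hq1 h5 k
  have hne : ∏' n : ℕ, ((1 - q ^ (5 * n + u)) * (1 - q ^ (5 * n + v))) ≠ 0 := by
    rw [(hm u).tprod_mul (hm v)]
    exact mul_ne_zero (tprod_one_sub_pow_ne_zero hq hq1 h5 hu)
      (tprod_one_sub_pow_ne_zero hq hq1 h5 hv)
  have hinv := ((hm u).mul (hm v)).inv₀ hne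
  simp only [← one_div] at hinv
  have hlim := ((tendsto_qInv_natCast hq hq1).comp h3).mul
    ((hm (2 + 2 * a)).hasProd.tendsto_prod_nat.mul (hm t).hasProd.tendsto_prod_nat)
  have hfin := tendsto_nhds_unique
    (hlim.congr fun n ↦ qInv_five_mul_mul_prod hq hq1 hu hv h n)
    ((tendsto_qInv_natCast hp hp1).mul hinv.hasProd.tendsto_prod_nat)
  have hG := tsum_pow_mul_qInv hq hq1 ha hs
  simp only [qInv_natCast, ← div_eq_mul_inv] at hG
  rw [hG]
  rw [← h1] at hfin
  exact mul_left_cancel₀ (qInvInf_ne_zero hp hp1) (by linarith)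

end

end RogersRamanujan

theorem stmt17 (q : ℝ) (hq : 0 < q) (hq1 : q < 1) :
    (∑' n : ℕ, q ^ (n ^ 2) / ∏ k ∈ Finset.range n, (1 - q ^ (k + 1))
        = ∏' n : ℕ, (1 / ((1 - q ^ (5 * n + 1)) * (1 - q ^ (5 * n + 4)))))
    ∧ (∑' n : ℕ, q ^ (n ^ 2 + n) / ∏ k ∈ Finset.range n, (1 - q ^ (k + 1))
        = ∏' n : ℕ, (1 / ((1 - q ^ (5 * n + 2)) * (1 - q ^ (5 * n + 3))))) := by
  constructor
  · have h := RogersRamanujan.rogers_ramanujan hq hq1 (a := 0) (t := 3) (u := 1) (v := 4)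
      (by norm_num) (by norm_num) (by norm_num) (by norm_num) fun i ↦ by ring
    simpa only [zero_mul, add_zero] using h
  · have h := RogersRamanujan.rogers_ramanujan hq hq1 (a := 1) (t := 1) (u := 2) (v := 3)
      (by norm_num) (by norm_num) (by norm_num) (by norm_num) fun i ↦ by ring
    simpa only [one_mul] using h
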